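/- Let A ∈ ℝ^{d×d} be Lyapunov stable, in the sense that every solution of γ̇(t) = A γ(t) is bounded on [0,∞). Then there exists a symmetric positive definite matrix P ∈ ℝ^{d×d} such that every solution γ of γ̇(t) = A γ(t) satisfies ⟨P γ(t), γ(t)⟩ ≤ ⟨P γ(0), γ(0)⟩ for all t ≥ 0 (i.e., the estimate V(γ(t)) ≤ V(γ(0)) e^{−λt} holds with λ = 0, V(ξ) = ⟨Pξ, ξ⟩). -/

import Mathlib

open scoped RealInnerProductSpace

/-- The quadratic Lyapunov-like function `ξ ↦ ⟨Pξ, ξ⟩` associated with a matrix `P`. -/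
noncomputable def quadForm {d : ℕ} (P : Matrix (Fin d) (Fin d) ℝ)
    (ξ : EuclideanSpace ℝ (Fin d)) : ℝ :=
  ⟪Matrix.toEuclideanLin P ξ, ξ⟫

open Filter Topology ContinuousLinearMap in
/-- A semigroup of operators, bounded for nonnegative times, has an idempotent limit point
at infinity. -/
theorem exists_idempotent_mapClusterPt {E : Type*} [NormedAddCommGroup E] [NormedSpace ℝ E]
    [FiniteDimensional ℝ E] {S : ℝ → E →L[ℝ] E} {M : ℝ}
    (hadd : ∀ s t, S (s + t) = S s * S t) (hM : ∀ t, 0 ≤ t → ‖S t‖ ≤ M) :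
    ∃ e : E →L[ℝ] E, MapClusterPt e atTop S ∧ e * e = e := by
  have : ProperSpace (E →L[ℝ] E) := FiniteDimensional.proper ℝ _
  have hK : IsCompact (Metric.closedBall (0 : E →L[ℝ] E) M) := isCompact_closedBall 0 M
  have hev : ∀ᶠ t in atTop, S t ∈ Metric.closedBall (0 : E →L[ℝ] E) M := by
    filter_upwards [eventually_ge_atTop 0] with t ht
    simpa using hM t ht
  have hclosed : IsClosed {X : E →L[ℝ] E | MapClusterPt X atTop S} :=
    isClosed_setOfPred_clusterPt
  refine exists_idempotent_in_compact_subsemigroup (fun r => continuous_mul_const r)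
    {X | MapClusterPt X atTop S} ?_ ?_ ?_
  · obtain ⟨X, -, hX⟩ := hK.exists_mapClusterPt_of_frequently hev.frequently
    exact ⟨X, hX⟩
  · refine hK.of_isClosed_subset hclosed fun X hX => ?_
    obtain ⟨U, hU, hUX⟩ := mapClusterPt_iff_ultrafilter.1 hX
    exact Metric.isClosed_closedBall.mem_of_tendsto hUX (hU hev)
  · intro X hX Y hY
    obtain ⟨U, hU, hUX⟩ := mapClusterPt_iff_ultrafilter.1 hX
    obtain ⟨V, hV, hVY⟩ := mapClusterPt_iff_ultrafilter.1 hY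
    have hsum : Tendsto (fun p : ℝ × ℝ => p.1 + p.2) (U ×ˢ V : Filter (ℝ × ℝ)) atTop :=
      (tendsto_fst.mono_right hU).atTop_add_atTop (tendsto_snd.mono_right hV)
    have hlim : Tendsto (fun p : ℝ × ℝ => S (p.1 + p.2)) (U ×ˢ V : Filter (ℝ × ℝ))
        (𝓝 (X * Y)) := by
      simp only [hadd]
      exact (hUX.comp tendsto_fst).mul (hVY.comp tendsto_snd)
    exact MapClusterPt.of_comp hsum hlim.mapClusterPt

section Energy

open ContinuousLinearMap

variable {E : Type*} [NormedAddCommGroup E] [InnerProductSpace ℝ E] [CompleteSpace E]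
  {S : ℝ → E →L[ℝ] E}

/-- The operator `∫₀ᵀ S(s)* S(s) ds`, whose quadratic form is `x ↦ ∫₀ᵀ ‖S(s) x‖² ds`. -/
noncomputable def energyOp (S : ℝ → E →L[ℝ] E) (T : ℝ) : E →L[ℝ] E :=
  ∫ s in (0 : ℝ)..T, adjoint (S s) * S s

theorem inner_energyOp (hS : Continuous S) (T : ℝ) (x : E) :
    ⟪energyOp S T x, x⟫ = ∫ s in (0 : ℝ)..T, ‖S s x‖ ^ 2 := by
  have hc : Continuous fun s => adjoint (S s) * S s := by fun_prop
  have h := ((innerSL ℝ x) ∘L (ContinuousLinearMap.apply ℝ E x)).intervalIntegral_comp_comm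
    (hc.intervalIntegrable (μ := MeasureTheory.volume) 0 T)
  rw [real_inner_comm]
  refine Eq.trans h.symm (intervalIntegral.integral_congr fun s _ => ?_)
  simp [adjoint_inner_right]

theorem norm_energyOp_le {M T : ℝ} (hT : 0 ≤ T) (hM : ∀ t, 0 ≤ t → ‖S t‖ ≤ M) :
    ‖energyOp S T‖ ≤ M ^ 2 * T := by
  have h := intervalIntegral.norm_integral_le_of_norm_le_const (a := 0) (b := T) (C := M ^ 2)
    (f := fun s => adjoint (S s) * S s) fun s hs => by
      rw [Set.uIoc_of_le hT] at hs
      have hs' := hM s hs.1.le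
      calc ‖adjoint (S s) * S s‖ ≤ ‖adjoint (S s)‖ * ‖S s‖ := norm_mul_le _ _
        _ = ‖S s‖ ^ 2 := by rw [LinearIsometryEquiv.norm_map, sq]
        _ ≤ M ^ 2 := by gcongr
  simpa [energyOp, abs_of_nonneg hT] using h

theorem inner_energyOp_apply_sub (hS : Continuous S) (hadd : ∀ s t, S (s + t) = S s * S t)
    (T t : ℝ) (x : E) :
    ⟪energyOp S T (S t x), S t x⟫ - ⟪energyOp S T x, x⟫ =
      ∫ s in (0 : ℝ)..t, (‖S (T + s) x‖ ^ 2 - ‖S s x‖ ^ 2) := by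
  have hc : Continuous fun s => ‖S s x‖ ^ 2 := by fun_prop
  have hi : ∀ a b, IntervalIntegrable (fun s => ‖S s x‖ ^ 2) MeasureTheory.volume a b :=
    fun a b => hc.intervalIntegrable a b
  have hcT : Continuous fun s => ‖S (T + s) x‖ ^ 2 := by fun_prop
  rw [inner_energyOp hS, inner_energyOp hS,
    intervalIntegral.integral_sub (hcT.intervalIntegrable _ _) (hi _ _),
    intervalIntegral.integral_comp_add_left (fun s => ‖S s x‖ ^ 2)]
  have h : ∀ s, ‖S s (S t x)‖ ^ 2 = ‖S (s + t) x‖ ^ 2 := fun s => by rw [hadd]; rfl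
  simp only [h]
  rw [intervalIntegral.integral_comp_add_right (fun s => ‖S s x‖ ^ 2)]
  have h1 := intervalIntegral.integral_add_adjacent_intervals (hi 0 t) (hi t (T + t))
  have h2 := intervalIntegral.integral_add_adjacent_intervals (hi 0 T) (hi T (T + t))
  simp only [zero_add, add_zero]
  linarith

open Filter Topology in
/-- A bounded semigroup leaves invariant a quadratic form, obtained as a limit of the averages
`T⁻¹ ∫₀ᵀ ‖S(s) x‖² ds`, which dominates every constant lower bound of `s ↦ ‖S(s) x‖²`. -/
theorem exists_invariant_form [FiniteDimensional ℝ E] (hS : Continuous S)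
    (hadd : ∀ s t, S (s + t) = S s * S t)
    {M : ℝ} (hM : ∀ t, 0 ≤ t → ‖S t‖ ≤ M) :
    ∃ G : E →L[ℝ] E, (∀ t, 0 ≤ t → ∀ x, ⟪G (S t x), S t x⟫ = ⟪G x, x⟫) ∧
      ∀ x c, (∀ s, 0 ≤ s → c ≤ ‖S s x‖ ^ 2) → c ≤ ⟪G x, x⟫ := by
  have : ProperSpace (E →L[ℝ] E) := FiniteDimensional.proper ℝ _
  have hK : IsCompact (Metric.closedBall (0 : E →L[ℝ] E) (M ^ 2)) := isCompact_closedBall 0 _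
  have hev : ∀ᶠ T : ℝ in atTop,
      T⁻¹ • energyOp S T ∈ Metric.closedBall (0 : E →L[ℝ] E) (M ^ 2) := by
    filter_upwards [eventually_gt_atTop 0] with T hT
    have := norm_energyOp_le hT.le hM
    rw [mem_closedBall_zero_iff, norm_smul, norm_inv, Real.norm_of_nonneg hT.le,
      inv_mul_le_iff₀ hT]
    linarith
  obtain ⟨G, -, hG⟩ := hK.exists_mapClusterPt_of_frequently hev.frequently
  obtain ⟨U, hU, hUG⟩ := mapClusterPt_iff_ultrafilter.1 hG
  have hlim : ∀ x, Tendsto (fun T : ℝ => T⁻¹ * ⟪energyOp S T x, x⟫) U (𝓝 ⟪G x, x⟫) := fun x => by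
    have hc : Continuous fun X : E →L[ℝ] E => ⟪X x, x⟫ := by fun_prop
    refine ((hc.tendsto G).comp hUG).congr fun T => ?_
    simp [real_inner_smul_left]
  refine ⟨G, fun t ht x => ?_, fun x c hc => ?_⟩
  · have hdiff := (hlim (S t x)).sub (hlim x)
    have hzero : Tendsto (fun T : ℝ => T⁻¹ * ⟪energyOp S T (S t x), S t x⟫ -
        T⁻¹ * ⟪energyOp S T x, x⟫) U (𝓝 0) := by
      refine Tendsto.mono_left ?_ hU
      have hb : Tendsto (fun T : ℝ => T⁻¹ * ((M * ‖x‖) ^ 2 * |t - 0|)) atTop (𝓝 0) := by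
        simpa using tendsto_inv_atTop_zero.mul_const ((M * ‖x‖) ^ 2 * |t - 0|)
      refine squeeze_zero_norm' ?_ hb
      filter_upwards [eventually_gt_atTop 0] with T hT
      rw [← mul_sub, inner_energyOp_apply_sub hS hadd, norm_mul, norm_inv,
        Real.norm_of_nonneg hT.le]
      gcongr
      refine intervalIntegral.norm_integral_le_of_norm_le_const fun s hs => ?_
      rw [Set.uIoc_of_le ht] at hs
      have hle : ∀ r, 0 ≤ r → ‖S r x‖ ^ 2 ≤ (M * ‖x‖) ^ 2 := fun r hr => by
        gcongr
        exact (S r).le_of_opNorm_le (hM r hr) x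
      have h1 := hle s hs.1.le
      have h2 := hle (T + s) (by linarith [hs.1])
      rw [Real.norm_eq_abs, abs_le]
      constructor <;> nlinarith [sq_nonneg ‖S s x‖, sq_nonneg ‖S (T + s) x‖]
    exact sub_eq_zero.1 (tendsto_nhds_unique hdiff hzero)
  · refine ge_of_tendsto (hlim x) (hU ?_)
    filter_upwards [eventually_gt_atTop 0] with T hT
    have hcont : Continuous fun s => ‖S s x‖ ^ 2 := by fun_prop
    have h := intervalIntegral.integral_mono_on hT.le
      (intervalIntegrable_const (μ := MeasureTheory.volume) (c := c))
      (hcont.intervalIntegrable _ _) fun s hs => hc s hs.1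
    rw [inner_energyOp hS, le_inv_mul_iff₀ hT]
    simpa using h

open Filter Topology in
/-- A bounded one-parameter semigroup on a finite-dimensional inner product space is a contraction
semigroup for some positive definite quadratic form. -/
theorem exists_form_nonincreasing [FiniteDimensional ℝ E] (hS : Continuous S)
    (hadd : ∀ s t, S (s + t) = S s * S t)
    (h0 : S 0 = 1) {M : ℝ} (hM : ∀ t, 0 ≤ t → ‖S t‖ ≤ M) :
    ∃ W : E →L[ℝ] E, (∀ x, x ≠ 0 → 0 < ⟪W x, x⟫) ∧
      ∀ t, 0 ≤ t → ∀ x, ⟪W (S t x), S t x⟫ ≤ ⟪W x, x⟫ := by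
  obtain ⟨e, he, hee⟩ := exists_idempotent_mapClusterPt hadd hM
  obtain ⟨G, hGinv, hGle⟩ := exists_invariant_form hS hadd hM
  obtain ⟨U, hU, hUe⟩ := mapClusterPt_iff_ultrafilter.1 he
  have hM0 : 0 ≤ M := (norm_nonneg _).trans (hM 0 le_rfl)
  have hcomm : ∀ t, e * S t = S t * e := fun t => by
    refine tendsto_nhds_unique (hUe.mul_const (S t)) ((hUe.const_mul (S t)).congr fun s => ?_)
    rw [← hadd, ← hadd, add_comm]
  have hnorm_e : ∀ x s, 0 ≤ s → ‖e x‖ ≤ M * ‖S s x‖ := fun x s hs => by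
    have hc : Continuous fun X : E →L[ℝ] E => ‖X x‖ := by fun_prop
    refine le_of_tendsto ((hc.tendsto e).comp hUe) (hU ?_)
    filter_upwards [eventually_ge_atTop s] with r hr
    have hr' : S r x = S (r - s) (S s x) := by
      rw [← mul_apply_eq_comp, ← hadd, sub_add_cancel]
    rw [Function.comp_apply, hr']
    exact (S (r - s)).le_of_opNorm_le (hM _ (by linarith)) _
  obtain ⟨T, hT, hT1⟩ : ∃ T : ℝ, 0 < T ∧ ‖S T * (1 - e)‖ < 1 := by
    have hlim : Tendsto (fun s => ‖S s * (1 - e)‖) U (𝓝 0) := by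
      have := (hUe.mul_const (1 - e)).norm
      rwa [mul_sub, mul_one, hee, sub_self, norm_zero] at this
    have hpos : ∀ᶠ s : ℝ in U, 0 < s := hU (eventually_gt_atTop 0)
    exact (hpos.and (hlim.eventually_lt_const one_pos)).exists
  have hker : ∀ z, e z = 0 → ‖S T z‖ ≤ ‖z‖ := fun z hz => by
    have h := (S T * (1 - e)).le_of_opNorm_le hT1.le z
    simpa [hz] using h
  set W : E →L[ℝ] E := G + adjoint (1 - e) * energyOp S T * (1 - e) with hWdef
  have hW : ∀ x, ⟪W x, x⟫ =
      ⟪G x, x⟫ + ⟪energyOp S T (x - e x), x - e x⟫ := fun x => by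
    rw [hWdef, _root_.add_apply, inner_add_left]
    congr 1
    exact adjoint_inner_left _ _ _
  have hG0 : ∀ x, 0 ≤ ⟪G x, x⟫ := fun x => hGle x 0 fun s _ => sq_nonneg _
  have hQ0 : ∀ x, 0 ≤ ⟪energyOp S T x, x⟫ := fun x => by
    rw [inner_energyOp hS]
    exact intervalIntegral.integral_nonneg hT.le fun s _ => sq_nonneg _
  refine ⟨W, fun x hx => ?_, fun t ht x => ?_⟩
  · rw [hW]
    by_cases hex : e x = 0
    · refine add_pos_of_nonneg_of_pos (hG0 x) ?_
      rw [hex, sub_zero, inner_energyOp hS]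
      have hc : Continuous fun s => ‖S s x‖ ^ 2 := by fun_prop
      refine intervalIntegral.integral_pos hT hc.continuousOn (fun s _ => sq_nonneg _)
        ⟨0, ⟨le_rfl, hT.le⟩, ?_⟩
      simpa [h0, sq_pos_iff] using hx
    · refine add_pos_of_pos_of_nonneg ?_ (hQ0 _)
      have hex' : 0 < ‖e x‖ := norm_pos_iff.2 hex
      have hMpos : 0 < M := by
        by_contra hneg
        have := hnorm_e x 0 le_rfl
        nlinarith [norm_nonneg (S 0 x)]
      refine lt_of_lt_of_le (by positivity : 0 < (‖e x‖ / M) ^ 2) (hGle x _ fun s hs => ?_)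
      gcongr
      rw [div_le_iff₀' hMpos]
      exact hnorm_e x s hs
  · rw [hW, hW, hGinv t ht]
    have hcx : e (S t x) = S t (e x) := congrArg (fun X : E →L[ℝ] E => X x) (hcomm t)
    rw [hcx, ← map_sub, add_le_add_iff_left, ← sub_nonpos, inner_energyOp_apply_sub hS hadd]
    have hey : e (x - e x) = 0 := by
      have : e (e x) = e x := congrArg (fun X : E →L[ℝ] E => X x) hee
      rw [map_sub, this, sub_self]
    rw [← neg_nonneg, ← intervalIntegral.integral_neg]
    refine intervalIntegral.integral_nonneg ht fun s _ => ?_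
    rw [neg_sub, sub_nonneg, hadd]
    gcongr
    refine hker _ ?_
    have := congrArg (fun X : E →L[ℝ] E => X (x - e x)) (hcomm s)
    simpa [hey] using this

end Energy

/-- A solution of `γ' = Aγ` is given by the exponential of `A`. -/
theorem eq_exp_smul_apply_of_hasDerivAt {E : Type*} [NormedAddCommGroup E] [NormedSpace ℝ E]
    [CompleteSpace E] (A : E →L[ℝ] E) {γ : ℝ → E} (hγ : ∀ t, HasDerivAt γ (A (γ t)) t) (t : ℝ) :
    γ t = NormedSpace.exp (t • A) (γ 0) := by
  have h : γ = fun t : ℝ => NormedSpace.exp (t • A) (γ 0) := by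
    refine ODE_solution_unique_univ (v := fun _ => A) (s := fun _ => Set.univ) (t₀ := 0)
      (fun _ => A.lipschitz.lipschitzOnWith) (fun t => ⟨hγ t, Set.mem_univ _⟩)
      (fun t => ⟨?_, Set.mem_univ _⟩) (by simp)
    simpa using (hasDerivAt_exp_smul_const' A t).clm_apply (hasDerivAt_const t (γ 0))
  exact congrFun h t

/-- If all solutions of `γ' = Lγ` are bounded on `[0,∞)`, then some positive definite quadratic
form is nonincreasing along all of them. -/
theorem exists_form_of_bounded_solutions {E : Type*} [NormedAddCommGroup E]
    [InnerProductSpace ℝ E] [FiniteDimensional ℝ E] (L : E →L[ℝ] E)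
    (hL : ∀ γ : ℝ → E, (∀ t, HasDerivAt γ (L (γ t)) t) → ∃ C, ∀ t, 0 ≤ t → ‖γ t‖ ≤ C) :
    ∃ W : E →L[ℝ] E, (∀ x, x ≠ 0 → 0 < ⟪W x, x⟫) ∧
      ∀ γ : ℝ → E, (∀ t, HasDerivAt γ (L (γ t)) t) →
        ∀ t, 0 ≤ t → ⟪W (γ t), γ t⟫ ≤ ⟪W (γ 0), γ 0⟫ := by
  have : CompleteSpace E := FiniteDimensional.complete ℝ E
  let _ : NormedAlgebra ℚ (E →L[ℝ] E) := NormedAlgebra.restrictScalars ℚ ℝ _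
  set S : ℝ → E →L[ℝ] E := fun t => NormedSpace.exp (t • L) with hSdef
  have hderiv : ∀ t, HasDerivAt S (L * S t) t := hasDerivAt_exp_smul_const' L
  have hS : Continuous S := continuous_iff_continuousAt.2 fun t => (hderiv t).continuousAt
  have hadd : ∀ s t, S (s + t) = S s * S t := fun s t => by
    rw [hSdef]
    beta_reduce
    rw [add_smul]
    exact NormedSpace.exp_add_of_commute (((Commute.refl L).smul_left s).smul_right t)
  obtain ⟨M, hM⟩ : ∃ M, ∀ t : Set.Ici (0 : ℝ), ‖S t‖ ≤ M := banach_steinhaus fun x => by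
    obtain ⟨C, hC⟩ := hL (fun t => S t x) fun t => by
      simpa using (hderiv t).clm_apply (hasDerivAt_const t x)
    exact ⟨C, fun t => hC t t.2⟩
  obtain ⟨W, hWpos, hWle⟩ := exists_form_nonincreasing hS hadd (by simp [S])
    fun t ht => hM ⟨t, ht⟩
  refine ⟨W, hWpos, fun γ hγ t ht => ?_⟩
  rw [eq_exp_smul_apply_of_hasDerivAt L hγ t]
  exact hWle t ht (γ 0)

/-- If `A` is Lyapunov stable, in the sense that every solution of `γ' = Aγ` is bounded on
`[0,∞)`, then there is a symmetric positive definite matrix `P` such that every solution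
satisfies `⟨P γ(t), γ(t)⟩ ≤ ⟨P γ(0), γ(0)⟩` for all `t ≥ 0` (the Lyapunov-like estimate
with `λ = 0`). -/
theorem stmt5 {d : ℕ} (A : Matrix (Fin d) (Fin d) ℝ)
    (hA : ∀ γ : ℝ → EuclideanSpace ℝ (Fin d),
      (∀ t : ℝ, HasDerivAt γ (Matrix.toEuclideanLin A (γ t)) t) →
      ∃ C : ℝ, ∀ t : ℝ, 0 ≤ t → ‖γ t‖ ≤ C) :
    ∃ P : Matrix (Fin d) (Fin d) ℝ, P.PosDef ∧
      ∀ γ : ℝ → EuclideanSpace ℝ (Fin d),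
        (∀ t : ℝ, HasDerivAt γ (Matrix.toEuclideanLin A (γ t)) t) →
        ∀ t : ℝ, 0 ≤ t → quadForm P (γ t) ≤ quadForm P (γ 0) := by
  set L : EuclideanSpace ℝ (Fin d) →L[ℝ] EuclideanSpace ℝ (Fin d) :=
    LinearMap.toContinuousLinearMap (Matrix.toEuclideanLin A)
  obtain ⟨W, hWpos, hWle⟩ := exists_form_of_bounded_solutions L hA
  set W' := W + ContinuousLinearMap.adjoint W
  set P := Matrix.toEuclideanLin.symm W'.toLinearMap
  have hP : Matrix.toEuclideanLin P = W'.toLinearMap := LinearEquiv.apply_symm_apply _ _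
  have hquad : ∀ x, quadForm P x = 2 * ⟪W x, x⟫ := fun x => by
    rw [quadForm, hP, ContinuousLinearMap.coe_coe, _root_.add_apply, inner_add_left,
      ContinuousLinearMap.adjoint_inner_left, real_inner_comm, two_mul]
  refine ⟨P, Matrix.PosDef.of_dotProduct_mulVec_pos ?_ fun x hx => ?_, fun γ hγ t ht => ?_⟩
  · rw [← Matrix.isSymmetric_toEuclideanLin_iff, hP]
    intro x y
    simp [W', inner_add_left, inner_add_right, ContinuousLinearMap.adjoint_inner_left,
      ContinuousLinearMap.adjoint_inner_right, add_comm]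
  · have hx' : WithLp.toLp 2 x ≠ 0 := fun h => hx (congrArg WithLp.ofLp h)
    have hpos : 0 < quadForm P (WithLp.toLp 2 x) := by
      rw [hquad]
      exact mul_pos two_pos (hWpos _ hx')
    rw [quadForm, EuclideanSpace.inner_eq_star_dotProduct, Matrix.toLpLin_apply] at hpos
    simpa using hpos
  · rw [hquad, hquad]
    exact mul_le_mul_of_nonneg_left (hWle γ hγ t ht) two_pos.le
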